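/- Two distinct labelled triangle-free connected graphs on the same vertex set of size at least 5 cannot have the same collection of connected triples. Equivalently: if G1 and G2 are connected triangle-free graphs on a common vertex set V with |V| ≥ 5, and every 3-element subset of V induces a connected subgraph in G1 if and only if it does in G2, then G1 = G2. -/

import Mathlib

open SimpleGraph

lemma SimpleGraph.Connected.exists_adj_boundary {V : Type*} {G : SimpleGraph V}
    (hc : G.Connected) (s : Set V) {x y : V} (hx : x ∈ s) (hy : y ∉ s) :
    ∃ a ∈ s, ∃ b ∉ s, G.Adj a b := by
  obtain ⟨p⟩ := hc.preconnected x y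
  obtain ⟨d, -, h1, h2⟩ := p.exists_boundary_dart s hx hy
  exact ⟨d.fst, h1, d.snd, h2, d.adj⟩

lemma SimpleGraph.induce_triple_connected {V : Type*} {G : SimpleGraph V} {x y z : V}
    (hxy : G.Adj x y) (hyz : G.Adj y z) : (G.induce {x, y, z}).Connected := by
  have h := (Walk.cons hxy (Walk.cons hyz Walk.nil)).connected_induce_support
  have hs : {v | v ∈ (Walk.cons hxy (Walk.cons hyz Walk.nil)).support} = ({x, y, z} : Set V) := by
    ext v
    simp
  rwa [hs] at h

lemma SimpleGraph.induce_triple_connected_iff {V : Type*} (G : SimpleGraph V) {x y z : V}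
    (hxy : x ≠ y) (hxz : x ≠ z) :
    (G.induce {x, y, z}).Connected ↔
      (G.Adj x y ∧ G.Adj y z) ∨ (G.Adj x y ∧ G.Adj x z) ∨ (G.Adj x z ∧ G.Adj y z) := by
  constructor
  · intro h
    have key : ∀ a b c : V, a ≠ b → ({x, y, z} : Set V) = {a, b, c} →
        G.Adj a b ∨ G.Adj a c := by
      intro a b c hab hs
      rw [hs] at h
      obtain ⟨⟨u, hu⟩, hu', ⟨v, hv⟩, hv', huv⟩ := h.exists_adj_boundary
        {w | w.1 = a} (x := ⟨a, by simp⟩) (y := ⟨b, by simp⟩) rfl (by simpa using hab.symm)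
      simp only [Set.mem_ofPred_eq] at hu' hv'
      simp only [comap_adj, Function.Embedding.subtype_apply] at huv
      subst hu'
      rcases hv with rfl | rfl | rfl
      · exact absurd rfl hv'
      · exact Or.inl huv
      · exact Or.inr huv
    have h1 := key x y z hxy rfl
    have h2 := key y x z hxy.symm (by grind)
    have h3 := key z x y hxz.symm (by grind)
    grind [G.adj_comm]
  · rintro (⟨h1, h2⟩ | ⟨h1, h2⟩ | ⟨h1, h2⟩)
    · exact induce_triple_connected h1 h2
    · rw [Set.insert_comm]
      exact induce_triple_connected h1.symm h2
    · rw [Set.pair_comm]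
      exact induce_triple_connected h1 h2.symm

lemma SimpleGraph.CliqueFree.not_adj_of_adj_of_adj {V : Type*} {G : SimpleGraph V}
    (h : G.CliqueFree 3) {x y z : V} (hxy : G.Adj x y) (hyz : G.Adj y z) : ¬ G.Adj x z := by
  classical
  exact fun hxz ↦ h {x, y, z} (is3Clique_triple_iff.2 ⟨hxy, hxz, hyz⟩)

lemma Fintype.exists_notMem_of_card_lt {V : Type*} [Fintype V] (s : Finset V)
    (h : s.card < Fintype.card V) : ∃ v, v ∉ s := by
  obtain ⟨v, -, hv⟩ := Finset.exists_mem_notMem_of_card_lt_card (s := s) (t := Finset.univ) h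
  exact ⟨v, hv⟩

/-- An edge `uv` of `G₁` whose endpoint `u` has a further neighbour is an edge of `G₂`,
given that the two graphs have the same connected triples. -/
lemma SimpleGraph.adj_of_connected_triples_of_adj {V : Type*} [Fintype V] {G₁ G₂ : SimpleGraph V}
    (hc : G₁.Connected) (ht₁ : G₁.CliqueFree 3) (ht₂ : G₂.CliqueFree 3)
    (hcard : 5 ≤ Fintype.card V)
    (h : ∀ {x y z : V}, x ≠ y → x ≠ z → y ≠ z →
      ((G₁.induce {x, y, z}).Connected ↔ (G₂.induce {x, y, z}).Connected))
    {u v a : V} (huv : G₁.Adj u v) (hua : G₁.Adj u a) (hav : a ≠ v) : G₂.Adj u v := by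
  classical
  by_contra hn
  have t₁ : ∀ {x y z : V}, G₁.Adj x y → G₁.Adj y z → ¬ G₁.Adj x z := ht₁.not_adj_of_adj_of_adj
  have t₂ : ∀ {x y z : V}, G₂.Adj x y → G₂.Adj y z → ¬ G₂.Adj x z := ht₂.not_adj_of_adj_of_adj
  have T : ∀ x y z : V, x ≠ y → x ≠ z → y ≠ z →
      ((G₁.Adj x y ∧ G₁.Adj y z) ∨ (G₁.Adj x y ∧ G₁.Adj x z) ∨ (G₁.Adj x z ∧ G₁.Adj y z) ↔
       (G₂.Adj x y ∧ G₂.Adj y z) ∨ (G₂.Adj x y ∧ G₂.Adj x z) ∨ (G₂.Adj x z ∧ G₂.Adj y z)) := by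
    intro x y z hxy hxz hyz
    rw [← induce_triple_connected_iff G₁ hxy hxz, ← induce_triple_connected_iff G₂ hxy hxz]
    exact h hxy hxz hyz
  clear h
  have hva : ¬ G₁.Adj v a := t₁ huv.symm hua
  -- further `G₁`-neighbours of `u` or `v` are common neighbours of `u` and `v` in `G₂`
  have nu : ∀ w, w ≠ v → G₁.Adj u w → G₂.Adj u w ∧ G₂.Adj v w := by
    intro w hw huw
    have := T u v w huv.ne huw.ne hw.symm
    tauto
  have nv : ∀ w, w ≠ u → G₁.Adj v w → G₂.Adj u w ∧ G₂.Adj v w := by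
    intro w hw hvw
    have := T u v w huv.ne hw.symm hvw.ne
    tauto
  have ha := nu a hav hua
  have uniq_u : ∀ w, w ≠ v → G₁.Adj u w → w = a := by
    intro w hw huw
    by_contra hwa
    have := T v a w hav.symm hw.symm (Ne.symm hwa)
    have := nu w hw huw
    have := t₁ huv.symm huw
    have := t₁ hua.symm huw
    tauto
  have uniq_v : ∀ b b', b ≠ u → b' ≠ u → G₁.Adj v b → G₁.Adj v b' → b = b' := by
    intro b b' hb hb' hvb hvb'
    by_contra hbb
    have := T u b b' hb.symm hb'.symm hbb
    have := nv b hb hvb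
    have := nv b' hb' hvb'
    have := t₁ huv hvb
    have := t₁ huv hvb'
    have := t₁ hvb.symm hvb'
    tauto
  have outer : ∀ w, w ≠ u → w ≠ v → w ≠ a → ¬ G₁.Adj v w → G₁.Adj a w →
      G₂.Adj u w ∧ ¬ G₂.Adj v w ∧ ¬ G₂.Adj a w := by
    intro w hwu hwv hwa hvw haw
    have := T u a w hua.ne hwu.symm hwa.symm
    have := T v a w hav.symm hwv.symm hwa.symm
    have := t₁ hua haw
    tauto
  have card_lt : ∀ x₁ x₂ x₃ x₄ : V, ∃ y, y ∉ ({x₁, x₂, x₃, x₄} : Finset V) := fun _ _ _ _ ↦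
    Fintype.exists_notMem_of_card_lt _ (Finset.card_le_four.trans_lt hcard)
  by_cases hB : ∃ b, b ≠ u ∧ G₁.Adj v b
  · obtain ⟨b, hbu, hvb⟩ := hB
    have hub : ¬ G₁.Adj u b := t₁ huv hvb
    have hb := nv b hbu hvb
    have hab : a ≠ b := by rintro rfl; exact hub hua
    have hnab : ¬ G₂.Adj a b := t₂ ha.1.symm hb.1
    have hadj : G₁.Adj a b := by
      have := T u a b hua.ne hbu.symm hab
      tauto
    obtain ⟨y, hy⟩ := card_lt u v a b
    obtain ⟨p, hp, w, hw, hpw⟩ := hc.exists_adj_boundary ({u, v, a, b} : Set V) (x := u) (y := y)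
      (by simp) (by simpa using hy)
    simp only [Set.mem_insert_iff, Set.mem_singleton_iff, not_or] at hp hw
    obtain ⟨hwu, hwv, hwa, hwb⟩ := hw
    have hvw : ¬ G₁.Adj v w := fun hvw ↦ hwb (uniq_v w b hwu hbu hvw hvb)
    have huw : ¬ G₁.Adj u w := fun huw ↦ hwa (uniq_u w hwv huw)
    have Tw := T a b w hab (Ne.symm hwa) (Ne.symm hwb)
    rcases hp with rfl | rfl | rfl | rfl
    · exact huw hpw
    · exact hvw hpw
    · have hnw := (outer w hwu hwv hwa hvw hpw).2.2
      rcases Tw.1 (.inr (.inl ⟨hadj, hpw⟩)) with h | h | h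
      exacts [hnab h.1, hnab h.1, hnw h.1]
    · rcases Tw.1 (.inl ⟨hadj, hpw⟩) with h | h | h
      · exact hnab h.1
      · exact hnab h.1
      · have Tu := T u p w hbu.symm (Ne.symm hwu) (Ne.symm hwb)
        rcases Tu.2 (.inl ⟨hb.1, h.2⟩) with h | h | h
        exacts [hub h.1, hub h.1, huw h.1]
  · push Not at hB
    obtain ⟨y, hy⟩ := card_lt u v a a
    obtain ⟨p, hp, w, hw, hpw⟩ := hc.exists_adj_boundary ({u, v, a} : Set V) (x := u) (y := y)
      (by simp) (by simpa using hy)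
    simp only [Set.mem_insert_iff, Set.mem_singleton_iff, not_or] at hp hw
    obtain ⟨hwu, hwv, hwa⟩ := hw
    have haw : G₁.Adj a w := by
      rcases hp with rfl | rfl | rfl
      · exact absurd (uniq_u w hwv hpw) hwa
      · exact absurd hpw (hB w hwu)
      · exact hpw
    have ow := outer w hwu hwv hwa (hB w hwu) haw
    obtain ⟨z, hz⟩ := card_lt u v a w
    obtain ⟨q, hq, x, hx, hqx⟩ := hc.exists_adj_boundary ({u, v, a, w} : Set V) (x := u) (y := z)
      (by simp) (by simpa using hz)
    simp only [Set.mem_insert_iff, Set.mem_singleton_iff, not_or] at hq hx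
    obtain ⟨hxu, hxv, hxa, hxw⟩ := hx
    have hux : ¬ G₁.Adj u x := fun hux ↦ hxa (uniq_u x hxv hux)
    have huw : ¬ G₁.Adj u w := fun huw ↦ hwa (uniq_u w hwv huw)
    have Tawx := T a w x (Ne.symm hwa) (Ne.symm hxa) (Ne.symm hxw)
    rcases hq with rfl | rfl | rfl | rfl
    · exact hux hqx
    · exact hB x hxu hqx
    · have hnx := (outer x hxu hxv hxa (hB x hxu) hqx).2.2
      rcases Tawx.1 (.inr (.inl ⟨haw, hqx⟩)) with h | h | h
      exacts [ow.2.2 h.1, ow.2.2 h.1, hnx h.1]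
    · rcases Tawx.1 (.inl ⟨haw, hqx⟩) with h | h | h
      · exact ow.2.2 h.1
      · exact ow.2.2 h.1
      · have Tu := T u q x (Ne.symm hwu) (Ne.symm hxu) (Ne.symm hxw)
        rcases Tu.2 (.inl ⟨ow.1, h.2⟩) with h | h | h
        exacts [huw h.1, huw h.1, hux h.1]

/-- Inclusion of graphs from equality of their connected triples. -/
lemma SimpleGraph.le_of_connected_triples {V : Type*} [Fintype V] {G₁ G₂ : SimpleGraph V}
    (hc : G₁.Connected) (ht₁ : G₁.CliqueFree 3) (ht₂ : G₂.CliqueFree 3)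
    (hcard : 5 ≤ Fintype.card V)
    (h : ∀ {x y z : V}, x ≠ y → x ≠ z → y ≠ z →
      ((G₁.induce {x, y, z}).Connected ↔ (G₂.induce {x, y, z}).Connected)) : G₁ ≤ G₂ := by
  classical
  intro u v huv
  obtain ⟨y, hy⟩ := Fintype.exists_notMem_of_card_lt {u, v}
    (Finset.card_le_two.trans_lt (by lia))
  obtain ⟨p, hp, a, ha, hpa⟩ := hc.exists_adj_boundary ({u, v} : Set V) (x := u) (y := y)
    (by simp) (by simpa using hy)
  simp only [Set.mem_insert_iff, Set.mem_singleton_iff, not_or] at hp ha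
  rcases hp with rfl | rfl
  · exact adj_of_connected_triples_of_adj hc ht₁ ht₂ hcard h huv hpa ha.2
  · exact (adj_of_connected_triples_of_adj hc ht₁ ht₂ hcard h huv.symm hpa ha.1).symm

theorem stmt8 {V : Type*} [Fintype V] (G1 G2 : SimpleGraph V)
    (hc1 : G1.Connected) (hc2 : G2.Connected)
    (ht1 : G1.CliqueFree 3) (ht2 : G2.CliqueFree 3)
    (hcard : 5 ≤ Fintype.card V)
    (h : ∀ S : Finset V, S.card = 3 →
      ((G1.induce (S : Set V)).Connected ↔ (G2.induce (S : Set V)).Connected)) :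
    G1 = G2 := by
  classical
  have key : ∀ {x y z : V}, x ≠ y → x ≠ z → y ≠ z →
      ((G1.induce {x, y, z}).Connected ↔ (G2.induce {x, y, z}).Connected) := by
    intro x y z hxy hxz hyz
    have hS := h {x, y, z} (Finset.card_eq_three.2 ⟨x, y, z, hxy, hxz, hyz, rfl⟩)
    have coe_triple : (({x, y, z} : Finset V) : Set V) = {x, y, z} := by simp
    rwa [coe_triple] at hS
  exact le_antisymm (le_of_connected_triples hc1 ht1 ht2 hcard key)
    (le_of_connected_triples hc2 ht2 ht1 hcard fun hxy hxz hyz ↦ (key hxy hxz hyz).symm)
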